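/- arXiv:1603.08843 — 8 statements merged into one kernel-verified Lean document; each statement's English description precedes it below -/
import Mathlib

section
/- Let ψ : ℝ → ℂ be a Schwartz function, a_m := 2^{((6m−1)^{6m−1})}, and F(ξ) := Σ_{m=1}^∞ ψ(ξ − a_m). Then F(a_n) → ψ(0) as n → ∞. Consequently, if ψ(0) ≠ 0, then F(ξ) does not tend to 0 as ξ → +∞. -/
open Filter

/-- The scale `ε_n = 2^{-(n^n)}`. -/
noncomputable def eps (n : ℕ) : ℝ := ((2 : ℝ) ^ (n ^ n))⁻¹

/-- The translation points `a_m = ε_{6m-1}⁻¹ = 2^{((6m-1)^{6m-1})}`. -/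
noncomputable def a (m : ℕ) : ℝ := (eps (6 * m - 1))⁻¹

/-- The sum `F(ξ) = Σ_{m=1}^∞ ψ(ξ − a_m)`. -/
noncomputable def F (ψ : SchwartzMap ℝ ℂ) (ξ : ℝ) : ℂ := ∑' m : ℕ, ψ (ξ - a (m + 1))

/-- The exponents `(6k+5)^(6k+5)` of the translation points are strictly increasing. -/
theorem strictMono_exponent : StrictMono fun k : ℕ => (6 * k + 5) ^ (6 * k + 5) := by
  intro k l hkl
  calc (6 * k + 5) ^ (6 * k + 5) < (6 * l + 5) ^ (6 * k + 5) :=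
        Nat.pow_lt_pow_left (by lia) (by lia)
    _ ≤ (6 * l + 5) ^ (6 * l + 5) := Nat.pow_le_pow_right (by lia) (by lia)

theorem a_succ (k : ℕ) : a (k + 1) = (2 : ℝ) ^ ((6 * k + 5) ^ (6 * k + 5)) := by
  have h : 6 * (k + 1) - 1 = 6 * k + 5 := by lia
  rw [a, eps, inv_inv, h]

theorem two_pow_le_two_mul_sub {i j : ℕ} (h : i < j) :
    (2 : ℝ) ^ j ≤ 2 * (2 ^ j - 2 ^ i) := by
  have : (2 : ℝ) ^ (i + 1) ≤ 2 ^ j := pow_le_pow_right₀ one_le_two h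
  rw [pow_succ] at this
  linarith

theorem two_pow_le_two_mul_abs_sub {i j : ℕ} (h : i ≠ j) :
    (2 : ℝ) ^ j ≤ 2 * |2 ^ i - 2 ^ j| := by
  rcases h.lt_or_gt with h | h
  · rw [abs_sub_comm]
    exact (two_pow_le_two_mul_sub h).trans (by gcongr; exact le_abs_self _)
  · refine (pow_le_pow_right₀ one_le_two h.le).trans ((two_pow_le_two_mul_sub h).trans ?_)
    gcongr
    exact le_abs_self _

theorem two_pow_le_two_mul_abs_a_sub {n m : ℕ} (h : n ≠ m) :
    (2 : ℝ) ^ m ≤ 2 * |a (n + 1) - a (m + 1)| := by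
  rw [a_succ, a_succ]
  exact (pow_le_pow_right₀ one_le_two (strictMono_exponent.le_apply (x := m))).trans
    (two_pow_le_two_mul_abs_sub (strictMono_exponent.injective.ne h))

theorem tendsto_a_succ : Tendsto (fun n : ℕ => a (n + 1)) atTop atTop := by
  simp only [a_succ]
  exact (tendsto_pow_atTop_atTop_of_one_lt one_lt_two).comp strictMono_exponent.tendsto_atTop

/-- Off-diagonal values of a Schwartz function decay geometrically in the index. -/
theorem exists_norm_apply_a_sub_le (ψ : SchwartzMap ℝ ℂ) :
    ∃ C : ℝ, ∀ n m : ℕ, n ≠ m → ‖ψ (a (n + 1) - a (m + 1))‖ ≤ C * (1 / 2) ^ m := by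
  obtain ⟨C, -, hψ⟩ := ψ.decay 1 0
  refine ⟨2 * C, fun n m h => ?_⟩
  have hx := hψ (a (n + 1) - a (m + 1))
  rw [norm_iteratedFDeriv_zero, pow_one, Real.norm_eq_abs] at hx
  have hm := mul_le_mul_of_nonneg_right (two_pow_le_two_mul_abs_a_sub h)
    (norm_nonneg (ψ (a (n + 1) - a (m + 1))))
  rw [one_div, inv_pow, ← div_eq_mul_inv, le_div_iff₀ (by positivity)]
  linarith

theorem tendsto_F_a (ψ : SchwartzMap ℝ ℂ) :
    Tendsto (fun n : ℕ => F ψ (a (n + 1))) atTop (nhds (ψ 0)) := by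
  obtain ⟨C, hC⟩ := exists_norm_apply_a_sub_le ψ
  have hsum : Summable fun m : ℕ => |C| * (1 / 2 : ℝ) ^ m :=
    summable_geometric_two.mul_left _
  let g : ℕ → ℕ → ℂ := fun n => Function.update (fun m => ψ (a (n + 1) - a (m + 1))) n 0
  have hg : ∀ n m, ‖g n m‖ ≤ |C| * (1 / 2) ^ m := by
    intro n m
    by_cases h : m = n
    · subst h
      simp only [g, Function.update_self, norm_zero]
      positivity
    · simp only [g, Function.update_of_ne h]
      exact (hC n m (Ne.symm h)).trans (by gcongr; exact le_abs_self C)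
  have hF : ∀ n, F ψ (a (n + 1)) = ψ 0 + ∑' m, g n m := by
    intro n
    have h := Summable.tsum_eq_add_tsum_ite' (f := fun m => ψ (a (n + 1) - a (m + 1))) n
      (hsum.of_norm_bounded (hg n))
    rw [F, h, sub_self]
    congr 2
    ext m
    simp only [g, Function.update_apply]
  have hlim : ∀ m, Tendsto (fun n => g n m) atTop (nhds 0) := by
    intro m
    have hψ : Tendsto (fun n : ℕ => ψ (a (n + 1) - a (m + 1))) atTop (nhds 0) :=
      (zero_at_infty ψ).comp <| (tendsto_atTop_add_const_right _ (-a (m + 1))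
        tendsto_a_succ).mono_right atTop_le_cocompact
    refine hψ.congr' ?_
    filter_upwards [eventually_ne_atTop m] with n hn
    simp only [g, Function.update_of_ne hn.symm]
  have h := tendsto_tsum_of_dominated_convergence hsum hlim (Eventually.of_forall hg)
  simp only [hF]
  simpa using h.const_add (ψ 0)

/-- `F(a_n) → ψ(0)` as `n → ∞`; hence if `ψ(0) ≠ 0`, then `F(ξ)` does not tend
to `0` as `ξ → +∞`. -/
theorem stmt5 (ψ : SchwartzMap ℝ ℂ) :
    Tendsto (fun n : ℕ => F ψ (a (n + 1))) atTop (nhds (ψ 0)) ∧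
    (ψ 0 ≠ 0 → ¬ Tendsto (F ψ) atTop (nhds 0)) := by
  refine ⟨tendsto_F_a ψ, fun h0 h => h0 ?_⟩
  exact tendsto_nhds_unique (tendsto_F_a ψ) (h.comp tendsto_a_succ)
end

section
/- Let ψ : ℝ → ℂ be a Schwartz function whose Fourier transform 𝓕ψ has compact support K, let a_m := 2^{((6m−1)^{6m−1})}, and F(ξ) := Σ_{m=1}^∞ ψ(ξ − a_m). Then for every Schwartz function φ : ℝ → ℂ vanishing on K one has ∫_ℝ F(ξ)·(𝓕φ)(ξ) dξ = 0. (This expresses that the tempered distribution with Fourier transform F has support contained in K, hence is compactly supported.) -/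
open MeasureTheory
open scoped FourierTransform

theorem two_pow_le_a_succ (m : ℕ) : (2 : ℝ) ^ m ≤ a (m + 1) := by
  have h : m ≤ (6 * (m + 1) - 1) ^ (6 * (m + 1) - 1) := calc
    m ≤ 6 * (m + 1) - 1 := by omega
    _ ≤ _ := Nat.le_self_pow (by omega) _
  simpa [a, eps] using pow_le_pow_right₀ (one_le_two : (1 : ℝ) ≤ 2) h

theorem fourier_comp_sub_eq_zero {f : ℝ → ℂ} {x : ℝ} (h : 𝓕 f x = 0) (c : ℝ) :
    𝓕 (fun ξ ↦ f (ξ - c)) x = 0 := by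
  have := congrFun (Fourier.fourierIntegral_comp_add_right Real.fourierChar volume f (-c)) x
  rw [Real.fourier_eq] at h
  simp only [Fourier.fourierIntegral_def] at this
  simp only [Real.fourier_eq]
  simp only [RCLike.inner_apply, conj_trivial, mul_comm] at h this ⊢
  rw [h] at this
  simpa [Function.comp_def, sub_eq_add_neg] using this

namespace SchwartzMap

theorem integral_comp_sub_mul_fourier_eq_zero (ψ φ : SchwartzMap ℝ ℂ)
    (h : ∀ x, 𝓕 (⇑ψ) x ≠ 0 → φ x = 0) (c : ℝ) :
    ∫ ξ, ψ (ξ - c) * 𝓕 (⇑φ) ξ = 0 := by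
  have key := integral_fourier_mul_eq (ψ.compSubConstCLM ℂ c) φ
  simp only [fourier_coe] at key
  refine key.symm.trans (integral_eq_zero_of_ae (.of_forall fun x ↦ ?_))
  by_cases hx : 𝓕 (⇑ψ) x = 0
  · exact mul_eq_zero_of_left (fourier_comp_sub_eq_zero hx c) _
  · exact mul_eq_zero_of_right _ (h x hx)

theorem integrable_comp_sub_mul (ψ g : SchwartzMap ℝ ℂ) (c : ℝ) :
    Integrable fun ξ ↦ ψ (ξ - c) * g ξ := by
  obtain ⟨C, -, hC⟩ := ψ.decay 0 0
  exact g.integrable.bdd_mul (c := C)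
    (ψ.continuous.comp (continuous_id.sub continuous_const)).aestronglyMeasurable
    (.of_forall fun ξ ↦ by simpa using hC (ξ - c))

theorem exists_mul_integral_norm_comp_sub_mul_le (ψ g : SchwartzMap ℝ ℂ) :
    ∃ C : ℝ, ∀ c : ℝ, c * ∫ ξ, ‖ψ (ξ - c) * g ξ‖ ≤ C := by
  obtain ⟨C₀, -, h₀⟩ := ψ.decay 0 0
  obtain ⟨C₁, -, h₁⟩ := ψ.decay 1 0
  have i₀ := (g.integrable (μ := volume)).norm.const_mul C₁
  have i₁ := (g.integrable_pow_mul volume 1).const_mul C₀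
  refine ⟨∫ ξ, (C₁ * ‖g ξ‖ + C₀ * (‖ξ‖ ^ 1 * ‖g ξ‖)), fun c ↦ ?_⟩
  rw [← integral_const_mul]
  refine integral_mono ((ψ.integrable_comp_sub_mul g c).norm.const_mul c) (i₀.add i₁) fun ξ ↦ ?_
  have b₀ : ‖ψ (ξ - c)‖ ≤ C₀ := by simpa using h₀ (ξ - c)
  have b₁ : |ξ - c| * ‖ψ (ξ - c)‖ ≤ C₁ := by simpa using h₁ (ξ - c)
  have hc : c ≤ |ξ - c| + |ξ| := by
    linarith [neg_abs_le (ξ - c), le_abs_self ξ]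
  simp only [norm_mul, pow_one, Real.norm_eq_abs]
  calc c * (‖ψ (ξ - c)‖ * ‖g ξ‖)
      ≤ (|ξ - c| + |ξ|) * (‖ψ (ξ - c)‖ * ‖g ξ‖) := by gcongr
    _ = (|ξ - c| * ‖ψ (ξ - c)‖) * ‖g ξ‖ + ‖ψ (ξ - c)‖ * (|ξ| * ‖g ξ‖) := by ring
    _ ≤ C₁ * ‖g ξ‖ + C₀ * (|ξ| * ‖g ξ‖) := by gcongr

theorem summable_integral_norm_comp_sub_mul (ψ g : SchwartzMap ℝ ℂ) {b : ℕ → ℝ}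
    (hb : ∀ m, 2 ^ m ≤ b m) :
    Summable fun m ↦ ∫ ξ, ‖ψ (ξ - b m) * g ξ‖ := by
  obtain ⟨C, hC⟩ := ψ.exists_mul_integral_norm_comp_sub_mul_le g
  refine .of_nonneg_of_le (fun m ↦ by positivity) (fun m ↦ ?_)
    (summable_geometric_two.mul_left C)
  have h : (2 : ℝ) ^ m * ∫ ξ, ‖ψ (ξ - b m) * g ξ‖ ≤ C :=
    (mul_le_mul_of_nonneg_right (hb m) (by positivity)).trans (hC (b m))
  rw [one_div, inv_pow, ← div_eq_mul_inv, le_div_iff₀' (by positivity)]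
  exact h

end SchwartzMap

/-- If `𝓕ψ` is supported in a compact set `K`, then `∫ F(ξ)·(𝓕φ)(ξ) dξ = 0` for every
Schwartz `φ` vanishing on `K`: the distribution with Fourier transform `F` is supported in
`K`, hence compactly supported. -/
theorem stmt8 (ψ : SchwartzMap ℝ ℂ) (K : Set ℝ) (hK : IsCompact K)
    (hsupp : Function.support (𝓕 (⇑ψ)) ⊆ K)
    (φ : SchwartzMap ℝ ℂ) (hφ : ∀ x ∈ K, φ x = 0) :
    (∫ ξ : ℝ, F ψ ξ * 𝓕 (⇑φ) ξ) = 0 := by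
  have hzero (m : ℕ) : ∫ ξ, ψ (ξ - a (m + 1)) * 𝓕 φ ξ = 0 :=
    ψ.integral_comp_sub_mul_fourier_eq_zero φ (fun x hx ↦ hφ x (hsupp hx)) _
  have hsum := integral_tsum_of_summable_integral_norm
    (fun m ↦ ψ.integrable_comp_sub_mul (𝓕 φ) (a (m + 1)))
    (ψ.summable_integral_norm_comp_sub_mul (𝓕 φ) two_pow_le_a_succ)
  simp only [hzero, tsum_zero, tsum_mul_right] at hsum
  exact hsum.symm
end

section
/- Let ψ : ℝ → ℂ be a Schwartz function, ε_n := 2^{-(n^n)}, and a_m := ε_{6m−1}^{−1}. Then for every p ∈ ℕ with p > 0 there exists N ∈ ℕ such that for all n ≥ N and all ξ ∈ ℝ, Σ_{m=1}^{n} (1+ξ²)^{p/2} |ψ(ξ − a_m)| ≤ (1/2)·ε_{6n}^{−1}. -/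
lemma SchwartzMap.exists_one_add_abs_pow_mul_norm_le (ψ : SchwartzMap ℝ ℂ) (p : ℕ) :
    ∃ c : ℕ, ∀ x : ℝ, (1 + |x|) ^ p * ‖ψ x‖ ≤ 2 ^ c := by
  obtain ⟨c, hc⟩ := pow_unbounded_of_one_lt
    (2 ^ p * ((Finset.Iic (p, 0)).sup fun m => SchwartzMap.seminorm ℝ m.1 m.2) ψ)
    (one_lt_two : (1 : ℝ) < 2)
  refine ⟨c, fun x => le_trans ?_ hc.le⟩
  simpa using SchwartzMap.one_add_le_sup_seminorm_apply (𝕜 := ℝ) (m := (p, 0))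
    (k := p) (n := 0) le_rfl le_rfl ψ x

lemma one_add_sq_rpow_half_le (ξ : ℝ) (p : ℕ) :
    (1 + ξ ^ 2) ^ ((p : ℝ) / 2) ≤ (1 + |ξ|) ^ p := by
  have h : 1 + ξ ^ 2 ≤ (1 + |ξ|) ^ 2 := by
    nlinarith [sq_abs ξ, abs_nonneg ξ]
  calc (1 + ξ ^ 2) ^ ((p : ℝ) / 2) ≤ ((1 + |ξ|) ^ 2) ^ ((p : ℝ) / 2) := by gcongr
    _ = (1 + |ξ|) ^ p := by
      rw [← Real.rpow_natCast (1 + |ξ|) 2, ← Real.rpow_mul (by positivity),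
        ← Real.rpow_natCast]
      congr 1
      push_cast
      ring

/-- Peetre's inequality for a translation by `t ≥ 1`. -/
lemma one_add_sq_rpow_half_le_translate {t : ℝ} (ht : 1 ≤ t) (ξ : ℝ) (p : ℕ) :
    (1 + ξ ^ 2) ^ ((p : ℝ) / 2) ≤ (2 * t) ^ p * (1 + |ξ - t|) ^ p := by
  refine (one_add_sq_rpow_half_le ξ p).trans ?_
  rw [← mul_pow]
  gcongr
  have h : |ξ| ≤ |ξ - t| + t := by
    simpa [abs_of_nonneg (zero_le_one.trans ht)] using abs_add_le (ξ - t) t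
  nlinarith [abs_nonneg (ξ - t)]

lemma a_eq (m : ℕ) : a m = 2 ^ ((6 * m - 1) ^ (6 * m - 1)) := by
  simp [a, eps]

lemma one_le_a (m : ℕ) : 1 ≤ a m := by
  rw [a_eq]
  exact one_le_pow₀ one_le_two

lemma a_le_a {m n : ℕ} (hm : 1 ≤ m) (hmn : m ≤ n) : a m ≤ a n := by
  rw [a_eq, a_eq]
  refine pow_le_pow_right₀ one_le_two ?_
  calc (6 * m - 1) ^ (6 * m - 1) ≤ (6 * n - 1) ^ (6 * m - 1) := by gcongr
    _ ≤ (6 * n - 1) ^ (6 * n - 1) := Nat.pow_le_pow_right (by omega) (by omega)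

lemma mul_self_pow_add_le {k p c : ℕ} (hk : p + c + 1 ≤ k) :
    p * k ^ k + c + k ≤ (k + 1) ^ (k + 1) := by
  have hkk : k ≤ k ^ k := Nat.le_self_pow (by omega) k
  calc p * k ^ k + c + k ≤ p * k ^ k + c * k ^ k + k ^ k := by
        gcongr
        exact Nat.le_mul_of_pos_right c (by omega)
    _ = (p + c + 1) * k ^ k := by ring
    _ ≤ (k + 1) * (k + 1) ^ k := by gcongr <;> omega
    _ = (k + 1) ^ (k + 1) := by ring

/-- For every `p > 0` there is `N` such that for all `n ≥ N` and all `ξ`,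
`Σ_{m=1}^{n} ⟨ξ⟩^p |ψ(ξ − a_m)| ≤ (1/2)·ε_{6n}⁻¹`. -/
theorem stmt9 (ψ : SchwartzMap ℝ ℂ) :
    ∀ p : ℕ, 0 < p → ∃ N : ℕ, ∀ n : ℕ, N ≤ n → ∀ ξ : ℝ,
      (∑ m ∈ Finset.Icc 1 n, (1 + ξ ^ 2) ^ ((p : ℝ) / 2) * ‖ψ (ξ - a m)‖) ≤
        (1 / 2) * (eps (6 * n))⁻¹ := by
  intro p _
  obtain ⟨c, hc⟩ := ψ.exists_one_add_abs_pow_mul_norm_le p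
  refine ⟨p + (p + c + 1) + 1, fun n hn ξ => ?_⟩
  have hterm : ∀ m ∈ Finset.Icc 1 n,
      (1 + ξ ^ 2) ^ ((p : ℝ) / 2) * ‖ψ (ξ - a m)‖ ≤ (2 * a n) ^ p * 2 ^ c := by
    intro m hm
    rw [Finset.mem_Icc] at hm
    have hpos : 0 ≤ a m := zero_le_one.trans (one_le_a m)
    have hle := a_le_a hm.1 hm.2
    have hpos_n : 0 ≤ a n := hpos.trans hle
    calc (1 + ξ ^ 2) ^ ((p : ℝ) / 2) * ‖ψ (ξ - a m)‖
        ≤ ((2 * a m) ^ p * (1 + |ξ - a m|) ^ p) * ‖ψ (ξ - a m)‖ := by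
          gcongr
          exact one_add_sq_rpow_half_le_translate (one_le_a m) ξ p
      _ = (2 * a m) ^ p * ((1 + |ξ - a m|) ^ p * ‖ψ (ξ - a m)‖) := by ring
      _ ≤ (2 * a n) ^ p * 2 ^ c := by
          gcongr
          exact hc _
  obtain ⟨k, hk⟩ : ∃ k, 6 * n = k + 1 := ⟨6 * n - 1, by omega⟩
  have ha : a n = 2 ^ (k ^ k) := by rw [a_eq, hk, Nat.add_sub_cancel]
  have hn2 : (n : ℝ) ≤ 2 ^ k := by
    exact_mod_cast (show n ≤ k by omega).trans Nat.lt_two_pow_self.le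
  have hexp := mul_self_pow_add_le (k := k) (p := p) (c := p + c + 1) (by omega)
  calc (∑ m ∈ Finset.Icc 1 n, (1 + ξ ^ 2) ^ ((p : ℝ) / 2) * ‖ψ (ξ - a m)‖)
      ≤ n * ((2 * a n) ^ p * 2 ^ c) := by
        simpa using Finset.sum_le_card_nsmul _ _ _ hterm
    _ ≤ 2 ^ k * ((2 * 2 ^ (k ^ k)) ^ p * 2 ^ c) := by rw [ha]; gcongr
    _ = (1 / 2) * 2 ^ (p * k ^ k + (p + c + 1) + k) := by
        rw [mul_pow, ← pow_mul]
        ring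
    _ ≤ (1 / 2) * 2 ^ ((k + 1) ^ (k + 1)) := by
        gcongr
        exact one_le_two
    _ = (1 / 2) * (eps (6 * n))⁻¹ := by rw [eps, inv_inv, hk]
end

section
/- Let ψ : ℝ → ℂ be a Schwartz function, ε_n := 2^{-(n^n)}, and a_m := ε_{6m−1}^{−1}. Then for every p ∈ ℕ there exists N ∈ ℕ such that for all n ≥ N and all ξ ∈ ℝ with |ξ| ≤ ε_{6n+4}^{−1}, Σ_{m=n+1}^{∞} (1+ξ²)^{p/2} |ψ(ξ − a_m)| ≤ 1. -/
theorem inv_eps (n : ℕ) : (eps n)⁻¹ = 2 ^ (n ^ n) := by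
  simp [eps]

theorem self_pow_self_add_le (k j : ℕ) (hk : 1 ≤ k) :
    k ^ k + j ≤ (k + j) ^ (k + j) := by
  induction j with
  | zero => simp
  | succ j ih =>
    have h : (k + j) ^ (k + j) < (k + (j + 1)) ^ (k + (j + 1)) :=
      calc (k + j) ^ (k + j) < (k + (j + 1)) ^ (k + j) :=
            Nat.pow_lt_pow_left (by omega) (by omega)
        _ ≤ (k + (j + 1)) ^ (k + (j + 1)) := Nat.pow_le_pow_right (by omega) (by omega)
    omega

theorem le_a_add (n j : ℕ) : 2 * (2 ^ j * (eps (6 * n + 4))⁻¹) ≤ a (n + 1 + j) := by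
  have h1 : 6 * (n + 1 + j) - 1 = (6 * n + 4) + (6 * j + 1) := by omega
  have h2 := self_pow_self_add_le (6 * n + 4) (6 * j + 1) (by omega)
  rw [a, h1, inv_eps, inv_eps, ← pow_add, ← pow_succ']
  exact pow_le_pow_right₀ one_le_two (by omega)

theorem two_pow_le_inv_eps (n : ℕ) : (2 : ℝ) ^ n ≤ (eps (6 * n + 4))⁻¹ := by
  rw [inv_eps]
  refine pow_le_pow_right₀ one_le_two ?_
  have := Nat.le_self_pow (n := 6 * n + 4) (by omega) (6 * n + 4)
  omega

theorem one_add_sq_rpow_le {B ξ : ℝ} (hB : 1 ≤ B) (hξ : |ξ| ≤ B) (p : ℕ) :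
    (1 + ξ ^ 2) ^ ((p : ℝ) / 2) ≤ (2 * B) ^ p := by
  have h : 1 + ξ ^ 2 ≤ (2 * B) ^ 2 := by
    have := sq_le_sq' (abs_le.mp hξ).1 (abs_le.mp hξ).2
    nlinarith
  calc (1 + ξ ^ 2) ^ ((p : ℝ) / 2) ≤ ((2 * B) ^ 2) ^ ((p : ℝ) / 2) :=
        Real.rpow_le_rpow (by positivity) h (by positivity)
    _ = (2 * B) ^ p := by
        rw [← Real.rpow_natCast (2 * B) 2, ← Real.rpow_mul (by positivity),
          ← Real.rpow_natCast (2 * B) p]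
        congr 1
        push_cast
        ring

theorem bracket_mul_norm_le {f : ℝ → ℂ} {C B ξ t : ℝ} {p : ℕ}
    (hC : ∀ x, |x| ^ (p + 1) * ‖f x‖ ≤ C) (hB : 1 ≤ B) (hξ : |ξ| ≤ B) (j : ℕ)
    (ht : 2 * (2 ^ j * B) ≤ t) :
    (1 + ξ ^ 2) ^ ((p : ℝ) / 2) * ‖f (ξ - t)‖ ≤ 2 ^ p * C / B * (1 / 2) ^ j := by
  have hB0 : 0 < B := by linarith
  have hj : (1 : ℝ) ≤ 2 ^ j := one_le_pow₀ one_le_two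
  have hC0 : 0 ≤ C := le_trans (by positivity) (hC 0)
  have hdist : 2 ^ j * B ≤ |ξ - t| := by
    rw [abs_sub_comm]
    refine le_trans ?_ (le_abs_self _)
    have := (abs_le.mp hξ).2
    nlinarith
  have hf : ‖f (ξ - t)‖ ≤ C / (2 ^ j * B) ^ (p + 1) := by
    rw [le_div_iff₀ (by positivity), mul_comm]
    exact le_trans (by gcongr) (hC (ξ - t))
  calc (1 + ξ ^ 2) ^ ((p : ℝ) / 2) * ‖f (ξ - t)‖
      ≤ (2 * B) ^ p * (C / (2 ^ j * B) ^ (p + 1)) := by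
        gcongr
        exact one_add_sq_rpow_le hB hξ p
    _ = 2 ^ p * C / B * (1 / 2) ^ j / (2 ^ j) ^ p := by
        simp only [mul_pow, pow_succ, div_pow, one_pow]
        field_simp
    _ ≤ 2 ^ p * C / B * (1 / 2) ^ j :=
        div_le_self (by positivity) (one_le_pow₀ hj)

/-- For every `p` there is `N` such that for all `n ≥ N` and all `|ξ| ≤ ε_{6n+4}⁻¹`,
`Σ_{m=n+1}^{∞} ⟨ξ⟩^p |ψ(ξ − a_m)| ≤ 1`. -/
theorem stmt11 (ψ : SchwartzMap ℝ ℂ) :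
    ∀ p : ℕ, ∃ N : ℕ, ∀ n : ℕ, N ≤ n → ∀ ξ : ℝ, |ξ| ≤ (eps (6 * n + 4))⁻¹ →
      (∑' m : ℕ, (1 + ξ ^ 2) ^ ((p : ℝ) / 2) * ‖ψ (ξ - a (n + 1 + m))‖) ≤ 1 := by
  intro p
  obtain ⟨C, hC⟩ := ψ.decay (p + 1) 0
  replace hC : ∀ x, |x| ^ (p + 1) * ‖ψ x‖ ≤ C := by simpa using hC.2
  obtain ⟨N, hN⟩ := pow_unbounded_of_one_lt (2 ^ p * C * 2) (one_lt_two (α := ℝ))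
  refine ⟨N, fun n hn ξ hξ => ?_⟩
  have hBn := two_pow_le_inv_eps n
  have hle := fun j => bracket_mul_norm_le hC ((one_le_pow₀ one_le_two).trans hBn) hξ j
    (le_a_add n j)
  set B := (eps (6 * n + 4))⁻¹
  have hB0 : 0 < B := lt_of_lt_of_le (by positivity) hBn
  have hsum := hasSum_geometric_two.mul_left (2 ^ p * C / B)
  have hs := Summable.of_nonneg_of_le (fun j => by positivity) hle hsum.summable
  refine (hs.tsum_le_tsum hle hsum.summable).trans ?_
  rw [hsum.tsum_eq, div_mul_eq_mul_div, div_le_one hB0]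
  exact hN.le.trans ((pow_le_pow_right₀ one_le_two hn).trans hBn)
end

section
/- Let φ : ℝ → ℂ be a Schwartz function and ε_n := 2^{-(n^n)}. Then for every p ∈ ℕ there exists N ∈ ℕ such that for all n ≥ N, all ε ∈ (ε_{6n+3}, ε_{6n}], and all ξ ∈ ℝ with |ξ| ≥ ε_{6n+4}^{−1}, one has |(𝓕φ)(εξ)| ≤ (1+ξ²)^{−p/2}. -/
open scoped FourierTransform

lemma eps_pos (n : ℕ) : 0 < eps n := by
  unfold eps
  positivity

lemma eps_succ_le_sq {m : ℕ} (hm : 1 ≤ m) : eps (m + 1) ≤ eps m ^ 2 := by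
  unfold eps
  rw [inv_pow, ← pow_mul]
  gcongr
  · norm_num
  · rw [pow_succ (m + 1) m]
    gcongr <;> omega

lemma natCast_le_inv_eps (m : ℕ) (hm : 1 ≤ m) : (m : ℝ) ≤ (eps m)⁻¹ := by
  unfold eps
  rw [inv_inv]
  have h : m ≤ 2 ^ (m ^ m) :=
    (Nat.le_self_pow (by omega) m).trans Nat.lt_two_pow_self.le
  exact_mod_cast h

lemma one_add_sq_rpow_neg_half (x : ℝ) (p : ℕ) :
    (1 + x ^ 2) ^ (-(p : ℝ) / 2) = (√(1 + x ^ 2) ^ p)⁻¹ := by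
  rw [Real.sqrt_eq_rpow, ← Real.rpow_natCast _ p, ← Real.rpow_mul (by positivity),
    ← Real.rpow_neg (by positivity)]
  congr 1
  ring

/-- For every `p` there is `N` such that for all `n ≥ N`, all `ε ∈ (ε_{6n+3}, ε_{6n}]` and all
`ξ` with `|ξ| ≥ ε_{6n+4}⁻¹`, one has `|(𝓕φ)(εξ)| ≤ ⟨ξ⟩^{-p}`. -/
theorem stmt12 (φ : SchwartzMap ℝ ℂ) :
    ∀ p : ℕ, ∃ N : ℕ, ∀ n : ℕ, N ≤ n → ∀ ε : ℝ, eps (6 * n + 3) < ε → ε ≤ eps (6 * n) →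
      ∀ ξ : ℝ, (eps (6 * n + 4))⁻¹ ≤ |ξ| →
        ‖𝓕 (⇑φ) (ε * ξ)‖ ≤ (1 + ξ ^ 2) ^ (-(p : ℝ) / 2) := by
  intro p
  obtain ⟨C, -, hC⟩ := (𝓕 φ).decay (2 * (p + 1)) 0
  obtain ⟨N, hN⟩ := exists_nat_ge (2 ^ p * C)
  refine ⟨N, fun n hn ε hε _ ξ hξ => ?_⟩
  have hbound := hC (ε * ξ)
  rw [norm_iteratedFDeriv_zero, SchwartzMap.fourier_coe] at hbound
  set F := ‖𝓕 (⇑φ) (ε * ξ)‖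
  have hF : 0 ≤ F := norm_nonneg _
  have hlarge : ((6 * n + 4 : ℕ) : ℝ) ≤ |ξ| := (natCast_le_inv_eps _ (by omega)).trans hξ
  push_cast at hlarge
  have hn' : (N : ℝ) ≤ n := by exact_mod_cast hn
  have hn0 : (0 : ℝ) ≤ n := n.cast_nonneg
  have hξ1 : 1 ≤ |ξ| := by linarith
  have hξC : 2 ^ p * C ≤ |ξ| := by linarith
  have hε2 : 1 ≤ ε ^ 2 * |ξ| := by
    have h1 : eps (6 * n + 4) ≤ ε ^ 2 :=
      (eps_succ_le_sq (by omega)).trans (pow_le_pow_left₀ (eps_pos _).le hε.le 2)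
    have h2 := eps_pos (6 * n + 4)
    calc 1 = eps (6 * n + 4) * (eps (6 * n + 4))⁻¹ := (mul_inv_cancel₀ h2.ne').symm
      _ ≤ ε ^ 2 * |ξ| := by gcongr
  have hy : |ξ| ≤ ‖ε * ξ‖ ^ 2 := by
    rw [Real.norm_eq_abs, sq_abs, mul_pow, ← sq_abs ξ]
    nlinarith
  have hdecay : |ξ| ^ (p + 1) * F ≤ C := by
    refine le_trans ?_ hbound
    rw [pow_mul]
    gcongr
  have hsqrt : √(1 + ξ ^ 2) ≤ 2 * |ξ| := by
    rw [Real.sqrt_le_left (by positivity), mul_pow, ← sq_abs ξ]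
    nlinarith
  have hprod : F * (2 * |ξ|) ^ p ≤ 1 := by
    refine le_of_mul_le_mul_right ?_ (by linarith : 0 < |ξ|)
    calc F * (2 * |ξ|) ^ p * |ξ| = 2 ^ p * (|ξ| ^ (p + 1) * F) := by ring
      _ ≤ 2 ^ p * C := by gcongr
      _ ≤ 1 * |ξ| := by rwa [one_mul]
  rw [one_add_sq_rpow_neg_half, ← one_div, le_div_iff₀ (by positivity)]
  exact le_trans (by gcongr) hprod
end

section
/- Let h : ℝ → ℂ and let w : ℝ → ℂ be continuous with w(0) = 1. Assume there exists N ∈ ℕ such that for every k ∈ ℕ there exists ε₀ ∈ (0,1] such that for all ε ∈ (0, ε₀] and all ξ ∈ ℝ, |ξ|^k · |h(ξ)| · |w(εξ)| ≤ ε^{−N}. Then h is rapidly decreasing: for every p ∈ ℕ there exists C > 0 such that |h(ξ)| ≤ C·(1+|ξ|)^{−p} for all ξ ∈ ℝ. -/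
/-- If `w` is continuous with `w(0) = 1` and there is `N` such that for every `k` one has
`|ξ|^k |h(ξ)| |w(εξ)| ≤ ε^{-N}` for all sufficiently small `ε > 0` and all `ξ`, then `h` is
rapidly decreasing. -/
theorem stmt16 (h w : ℝ → ℂ) (hw_cont : Continuous w) (hw0 : w 0 = 1)
    (H : ∃ N : ℕ, ∀ k : ℕ, ∃ ε₀ : ℝ, ε₀ ∈ Set.Ioc (0 : ℝ) 1 ∧
      ∀ ε : ℝ, ε ∈ Set.Ioc (0 : ℝ) ε₀ → ∀ ξ : ℝ, |ξ| ^ k * ‖h ξ‖ * ‖w (ε * ξ)‖ ≤ ε⁻¹ ^ N) :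
    ∀ p : ℕ, ∃ C : ℝ, 0 < C ∧ ∀ ξ : ℝ, ‖h ξ‖ ≤ C * ((1 + |ξ|)⁻¹) ^ p := by
  obtain ⟨N, H⟩ := H
  intro p
  obtain ⟨δ, hδ, hw⟩ : ∃ δ > 0, ∀ t : ℝ, |t| < δ → 1 / 2 < ‖w t‖ := by
    have hev : ∀ᶠ t in nhds (0 : ℝ), 1 / 2 < ‖w t‖ :=
      hw_cont.norm.continuousAt.eventually_const_lt (by norm_num [hw0])
    obtain ⟨δ, hδ, hball⟩ := Metric.eventually_nhds_iff.1 hev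
    exact ⟨δ, hδ, fun t ht => hball (by simpa using ht)⟩
  obtain ⟨ε₁, ⟨hε₁, -⟩, H₁⟩ := H (N + p)
  obtain ⟨ε₂, ⟨hε₂, -⟩, H₂⟩ := H 0
  obtain ⟨a, ha, ha'⟩ := exists_between (lt_min hδ (lt_min hε₁ hε₂))
  obtain ⟨haδ, ha₁, ha₂⟩ : a < δ ∧ a < ε₁ ∧ a < ε₂ := by simpa using ha'
  refine ⟨2 ^ (N + p - 1) * (4 * a⁻¹ ^ N), by positivity, fun ξ => ?_⟩
  have hx : 0 < 1 + |ξ| := by positivity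
  have hεa : a / (1 + |ξ|) ≤ a := div_le_self ha.le (by linarith [abs_nonneg ξ])
  have hε : 0 < a / (1 + |ξ|) := by positivity
  have hw' : 1 / 2 < ‖w (a / (1 + |ξ|) * ξ)‖ := by
    apply hw
    rw [abs_mul, abs_of_pos hε, div_mul_eq_mul_div, div_lt_iff₀ hx]
    nlinarith [abs_nonneg ξ]
  have h₁ := H₁ _ ⟨hε, hεa.trans ha₁.le⟩ ξ
  have h₂ := H₂ _ ⟨hε, hεa.trans ha₂.le⟩ ξ
  have hinv : (a / (1 + |ξ|))⁻¹ ^ N = a⁻¹ ^ N * (1 + |ξ|) ^ N := by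
    rw [inv_div, div_eq_inv_mul, mul_pow]
  rw [hinv] at h₁ h₂
  have key : (1 + |ξ| ^ (N + p)) * ‖h ξ‖ ≤ 4 * (a⁻¹ ^ N * (1 + |ξ|) ^ N) := by
    have hmul := mul_le_mul_of_nonneg_left hw'.le
      (show 0 ≤ (1 + |ξ| ^ (N + p)) * ‖h ξ‖ by positivity)
    rw [pow_zero] at h₂
    linarith
  have hpow : (1 + |ξ|) ^ (N + p) ≤ 2 ^ (N + p - 1) * (1 + |ξ| ^ (N + p)) := by
    simpa using add_pow_le zero_le_one (abs_nonneg ξ) (N + p)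
  rw [inv_pow (1 + |ξ|), ← div_eq_mul_inv _ ((1 + |ξ|) ^ p), le_div_iff₀ (by positivity)]
  refine le_of_mul_le_mul_right ?_ (pow_pos hx N)
  calc ‖h ξ‖ * (1 + |ξ|) ^ p * (1 + |ξ|) ^ N = (1 + |ξ|) ^ (N + p) * ‖h ξ‖ := by ring
    _ ≤ 2 ^ (N + p - 1) * (1 + |ξ| ^ (N + p)) * ‖h ξ‖ := by gcongr
    _ = 2 ^ (N + p - 1) * ((1 + |ξ| ^ (N + p)) * ‖h ξ‖) := by rw [mul_assoc]
    _ ≤ 2 ^ (N + p - 1) * (4 * (a⁻¹ ^ N * (1 + |ξ|) ^ N)) := by gcongr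
    _ = 2 ^ (N + p - 1) * (4 * a⁻¹ ^ N) * (1 + |ξ|) ^ N := by ring
end

section
/- (Function-level avatar of the standard theorem G^∞(Ω) ∩ ι(D′(Ω)) = C^∞(Ω).) Let f : ℝ → ℂ be integrable with compact support, let φ be a Schwartz function with ∫_ℝ φ = 1, and set φ_ε(x) := ε^{−1}φ(x/ε). Assume there exists N ∈ ℕ such that for every k ∈ ℕ there exists ε₀ ∈ (0,1] with ∫_ℝ |(f∗φ_ε)^{(k)}(x)| dx ≤ ε^{−N} for all ε ∈ (0, ε₀]. Then the Fourier transform 𝓕f is rapidly decreasing: for every p ∈ ℕ there exists C > 0 with |(𝓕f)(ξ)| ≤ C·(1+|ξ|)^{−p} for all ξ ∈ ℝ. -/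
open MeasureTheory
open scoped FourierTransform

/-- The mollified net `f ∗ φ_ε`, where `φ_ε(x) = ε⁻¹ φ(x/ε)`. -/
noncomputable def conv (f : ℝ → ℂ) (φ : SchwartzMap ℝ ℂ) (ε : ℝ) (x : ℝ) : ℂ :=
  ∫ t : ℝ, f t * (((ε : ℂ))⁻¹ * φ ((x - t) / ε))

open scoped Convolution

lemma conv_eq_convolution (f : ℝ → ℂ) (φ : SchwartzMap ℝ ℂ) (ε : ℝ) :
    conv f φ ε = f ⋆[ContinuousLinearMap.mul ℂ ℂ] fun x => (ε : ℂ)⁻¹ * φ (x / ε) :=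
  rfl

lemma integrable_mollifier (φ : SchwartzMap ℝ ℂ) {ε : ℝ} (hε : 0 < ε) :
    Integrable fun x : ℝ => (ε : ℂ)⁻¹ * φ (x / ε) :=
  (φ.integrable.comp_div hε.ne').const_mul _

lemma integrable_conv {f : ℝ → ℂ} (hf : Integrable f) (φ : SchwartzMap ℝ ℂ) {ε : ℝ}
    (hε : 0 < ε) : Integrable (conv f φ ε) := by
  rw [conv_eq_convolution]
  exact hf.integrable_convolution _ (integrable_mollifier φ hε)

lemma fourier_mollifier (φ : SchwartzMap ℝ ℂ) {ε : ℝ} (hε : 0 < ε) (ξ : ℝ) :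
    𝓕 (fun x : ℝ => (ε : ℂ)⁻¹ * φ (x / ε)) ξ = 𝓕 (φ : ℝ → ℂ) (ε * ξ) := by
  rw [Real.fourier_real_eq_integral_exp_smul, Real.fourier_real_eq_integral_exp_smul]
  have h := Measure.integral_comp_div
    (fun y : ℝ => Complex.exp (↑(-2 * Real.pi * y * (ε * ξ)) * Complex.I) • φ y) ε
  have hε' : (ε : ℂ) ≠ 0 := by exact_mod_cast hε.ne'
  rw [abs_of_pos hε] at h
  calc
    _ = ∫ x : ℝ, (ε : ℂ)⁻¹ *
        (Complex.exp (↑(-2 * Real.pi * (x / ε) * (ε * ξ)) * Complex.I) • φ (x / ε)) := by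
      congr 1 with x
      have : -2 * Real.pi * (x / ε) * (ε * ξ) = -2 * Real.pi * x * ξ := by field_simp
      rw [this, smul_eq_mul, smul_eq_mul]
      ring
    _ = _ := by
      rw [integral_const_mul, h, Complex.real_smul, inv_mul_cancel_left₀ hε']

lemma fourier_conv {f : ℝ → ℂ} (hf : Integrable f) (φ : SchwartzMap ℝ ℂ) {ε : ℝ}
    (hε : 0 < ε) (ξ : ℝ) :
    𝓕 (conv f φ ε) ξ = 𝓕 f ξ * 𝓕 (φ : ℝ → ℂ) (ε * ξ) := by
  rw [conv_eq_convolution, Real.fourier_mul_convolution_eq hf (integrable_mollifier φ hε),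
    fourier_mollifier φ hε]

lemma hasDerivAt_conv {f : ℝ → ℂ} (hf : Integrable f) (φ : SchwartzMap ℝ ℂ) (ε x : ℝ) :
    HasDerivAt (conv f φ ε)
      ((ε : ℂ)⁻¹ * conv f (SchwartzMap.derivCLM ℂ ℂ φ) ε x) x := by
  have hmeas (ψ : SchwartzMap ℝ ℂ) (y : ℝ) :
      AEStronglyMeasurable (fun t => f t * ((ε : ℂ)⁻¹ * ψ ((y - t) / ε))) := by
    refine hf.aestronglyMeasurable.mul (Continuous.aestronglyMeasurable ?_)
    have := ψ.continuous
    fun_prop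
  have hbound (ψ : SchwartzMap ℝ ℂ) (y t : ℝ) :
      ‖f t * ((ε : ℂ)⁻¹ * ψ ((y - t) / ε))‖ ≤
        ‖f t‖ * (‖(ε : ℂ)⁻¹‖ * SchwartzMap.seminorm ℝ 0 0 ψ) := by
    rw [norm_mul, norm_mul]
    gcongr
    exact ψ.norm_le_seminorm ℝ _
  set φ' := SchwartzMap.derivCLM ℂ ℂ φ
  have key := hasDerivAt_integral_of_dominated_loc_of_deriv_le (μ := volume) (s := Set.univ)
    (x₀ := x) (F := fun y t => f t * ((ε : ℂ)⁻¹ * φ ((y - t) / ε)))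
    (F' := fun y t => (ε : ℂ)⁻¹ * (f t * ((ε : ℂ)⁻¹ * φ' ((y - t) / ε))))
    (bound := fun t => ‖(ε : ℂ)⁻¹‖ *
      (‖f t‖ * (‖(ε : ℂ)⁻¹‖ * SchwartzMap.seminorm ℝ 0 0 φ')))
    Filter.univ_mem (.of_forall (hmeas φ))
    ((hf.norm.mul_const _).mono' (hmeas φ x) (.of_forall (hbound φ x)))
    ((hmeas φ' x).const_mul _)
    (.of_forall fun t y _ => by
      rw [norm_mul]
      gcongr
      exact hbound φ' y t)
    ((hf.norm.mul_const _).const_mul _)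
    (.of_forall fun t y _ => by
      have h1 : HasDerivAt (fun y : ℝ => (y - t) / ε) (1 / ε) y :=
        ((hasDerivAt_id y).sub_const t).div_const ε
      have h2 := (((φ.hasDerivAt ((y - t) / ε)).scomp y h1).const_mul (ε : ℂ)⁻¹).const_mul (f t)
      refine h2.congr_deriv ?_
      rw [SchwartzMap.derivCLM_apply, Complex.real_smul]
      push_cast
      ring)
  have h := key.2
  rw [integral_const_mul] at h
  exact h

lemma iteratedDeriv_conv {f : ℝ → ℂ} (hf : Integrable f) (φ : SchwartzMap ℝ ℂ) (ε : ℝ)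
    (k : ℕ) : iteratedDeriv k (conv f φ ε) =
      fun x => (ε : ℂ)⁻¹ ^ k * conv f ((SchwartzMap.derivCLM ℂ ℂ)^[k] φ) ε x := by
  induction k with
  | zero => simp
  | succ k ih =>
    ext x
    rw [iteratedDeriv_succ, ih, ((hasDerivAt_conv hf _ ε x).const_mul _).deriv,
      Function.iterate_succ_apply', pow_succ, mul_assoc]

lemma fourier_iteratedDeriv_conv {f : ℝ → ℂ} (hf : Integrable f) (φ : SchwartzMap ℝ ℂ) {ε : ℝ}
    (hε : 0 < ε) (k : ℕ) (ξ : ℝ) :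
    𝓕 (iteratedDeriv k (conv f φ ε)) ξ =
      (2 * Real.pi * Complex.I * ξ) ^ k * (𝓕 f ξ * 𝓕 (φ : ℝ → ℂ) (ε * ξ)) := by
  have hsmooth : ContDiff ℝ (⊤ : ℕ∞) (conv f φ ε) := by
    refine contDiff_of_differentiable_iteratedDeriv fun m _ => ?_
    rw [iteratedDeriv_conv hf]
    exact fun x => ((hasDerivAt_conv hf _ ε x).const_mul _).differentiableAt
  have hint (n : ℕ) : Integrable (iteratedDeriv n (conv f φ ε)) := by
    rw [iteratedDeriv_conv hf]
    exact (integrable_conv hf _ hε).const_mul _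
  rw [Real.fourier_iteratedDeriv hsmooth (fun n _ => hint n) le_top]
  simp only [smul_eq_mul, fourier_conv hf φ hε]

lemma norm_fourier_le_integral_norm (f : ℝ → ℂ) (ξ : ℝ) : ‖𝓕 f ξ‖ ≤ ∫ x, ‖f x‖ :=
  VectorFourier.norm_fourierIntegral_le_integral_norm _ _ _ _ _

lemma pow_mul_norm_fourier_le {f : ℝ → ℂ} (hf : Integrable f) (φ : SchwartzMap ℝ ℂ) {ε : ℝ}
    (hε : 0 < ε) (k : ℕ) (ξ : ℝ) :
    (2 * Real.pi * |ξ|) ^ k * (‖𝓕 f ξ‖ * ‖𝓕 (φ : ℝ → ℂ) (ε * ξ)‖) ≤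
      ∫ x : ℝ, ‖iteratedDeriv k (conv f φ ε) x‖ := by
  have h := norm_fourier_le_integral_norm (iteratedDeriv k (conv f φ ε)) ξ
  rw [fourier_iteratedDeriv_conv hf φ hε] at h
  simpa [abs_of_pos Real.pi_pos] using h

lemma exists_half_le_norm_fourier (φ : SchwartzMap ℝ ℂ) (hφ : (∫ x : ℝ, φ x) = 1) :
    ∃ δ > 0, ∀ η : ℝ, |η| ≤ δ → 1 / 2 ≤ ‖𝓕 (φ : ℝ → ℂ) η‖ := by
  have hcont : Continuous fun η => ‖𝓕 (φ : ℝ → ℂ) η‖ := by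
    rw [← SchwartzMap.fourier_coe]
    exact (𝓕 φ).continuous.norm
  have h0 : 1 / 2 < ‖𝓕 (φ : ℝ → ℂ) 0‖ := by
    rw [Real.fourier_real_eq_integral_exp_smul]
    norm_num [hφ]
  obtain ⟨δ, hδ, h⟩ :=
    Metric.nhds_basis_closedBall.eventually_iff.1 (hcont.continuousAt.eventually_const_lt h0)
  exact ⟨δ, hδ, fun η hη => (h (by simpa using hη)).le⟩

/-- Function-level avatar of `G^∞(Ω) ∩ ι(D′(Ω)) = C^∞(Ω)`: if `f` is integrable with compact
support, `∫φ = 1`, and the net `(f ∗ φ_ε)_ε` satisfies a `G^∞`-type global `L¹` bound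
`∫ |(f∗φ_ε)^{(k)}| ≤ ε^{-N}` with `N` independent of `k`, then `𝓕f` is rapidly decreasing. -/
theorem stmt17 (f : ℝ → ℂ) (hf : Integrable f) (hsupp : HasCompactSupport f)
    (φ : SchwartzMap ℝ ℂ) (hφ : (∫ x : ℝ, φ x) = 1)
    (H : ∃ N : ℕ, ∀ k : ℕ, ∃ ε₀ : ℝ, ε₀ ∈ Set.Ioc (0 : ℝ) 1 ∧
      ∀ ε : ℝ, ε ∈ Set.Ioc (0 : ℝ) ε₀ →
        (∫ x : ℝ, ‖iteratedDeriv k (conv f φ ε) x‖) ≤ ε⁻¹ ^ N) :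
    ∀ p : ℕ, ∃ C : ℝ, 0 < C ∧ ∀ ξ : ℝ, ‖𝓕 f ξ‖ ≤ C * ((1 + |ξ|)⁻¹) ^ p := by
  intro p
  obtain ⟨N, H⟩ := H
  obtain ⟨ε₀, ⟨hε₀, -⟩, H⟩ := H (N + p)
  obtain ⟨δ, hδ, hφδ⟩ := exists_half_le_norm_fourier φ hφ
  set R := max (δ / ε₀) 1
  have hnorm : 0 ≤ ∫ x, ‖f x‖ := integral_nonneg fun _ => norm_nonneg _
  have hR : 0 < R := lt_max_of_lt_right one_pos
  refine ⟨2 * δ⁻¹ ^ N + (∫ x, ‖f x‖) * (1 + R) ^ p, by positivity, fun ξ => ?_⟩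
  rw [inv_pow (1 + |ξ|), ← div_eq_mul_inv, le_div_iff₀ (by positivity)]
  rcases le_total |ξ| R with hξ | hξ
  · have : ‖𝓕 f ξ‖ * (1 + |ξ|) ^ p ≤ (∫ x, ‖f x‖) * (1 + R) ^ p := by
      gcongr
      exact norm_fourier_le_integral_norm f ξ
    have : 0 ≤ 2 * δ⁻¹ ^ N := by positivity
    linarith
  · have hξ1 : 1 ≤ |ξ| := (le_max_right _ _).trans hξ
    have hξ0 : 0 < |ξ| := one_pos.trans_le hξ1
    have hε : 0 < δ / |ξ| := by positivity
    have hεle : δ / |ξ| ≤ ε₀ := by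
      rw [div_le_iff₀ hξ0, mul_comm, ← div_le_iff₀ hε₀]
      exact (le_max_left _ _).trans hξ
    have hhalf : 1 / 2 ≤ ‖𝓕 (φ : ℝ → ℂ) (δ / |ξ| * ξ)‖ := by
      apply hφδ
      rw [abs_mul, abs_of_pos hε, div_mul_cancel₀ _ hξ0.ne']
    have hupper := (pow_mul_norm_fourier_le hf φ hε (N + p) ξ).trans (H _ ⟨hε, hεle⟩)
    have hpi := Real.pi_gt_three
    have hlower : (|ξ| ^ N * (1 + |ξ|) ^ p) * (‖𝓕 f ξ‖ * (1 / 2)) ≤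
        (2 * Real.pi * |ξ|) ^ (N + p) *
          (‖𝓕 f ξ‖ * ‖𝓕 (φ : ℝ → ℂ) (δ / |ξ| * ξ)‖) := by
      rw [pow_add]
      gcongr <;> nlinarith
    have hbound : ‖𝓕 f ξ‖ * (1 + |ξ|) ^ p ≤ 2 * δ⁻¹ ^ N := by
      refine le_of_mul_le_mul_left ?_ (pow_pos hξ0 N)
      have h := hlower.trans hupper
      rw [inv_div, div_eq_mul_inv |ξ|, mul_pow] at h
      linarith
    have : 0 ≤ (∫ x, ‖f x‖) * (1 + R) ^ p := by positivity
    linarith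
end

section
/- (Headline counterexample, function-level.) Let ε_n := 2^{-(n^n)}. There exists a smooth function F : ℝ → ℂ, bounded together with all its derivatives, such that F(ξ) does not tend to 0 as ξ → +∞ (so F is not a Schwartz function), and yet for every Schwartz function φ : ℝ → ℂ and every p ∈ ℕ there exists N ∈ ℕ such that for all n ≥ N, all ε ∈ (ε_{6n+3}, ε_{6n}], and all ξ ∈ ℝ, (1+ξ²)^{p/2} · |F(ξ)| · |(𝓕φ)(εξ)| ≤ ε^{−1}. -/
open Filter
open scoped FourierTransform

lemma mul_pow_self_le {a m M : ℕ} (hm : m < M) (ha : a ≤ M) : a * m ^ m ≤ M ^ M := by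
  calc a * m ^ m ≤ M * M ^ (M - 1) := by
        refine Nat.mul_le_mul ha ((Nat.pow_le_pow_left hm.le m).trans ?_)
        exact Nat.pow_le_pow_right (by omega) (by omega)
    _ = M ^ M := mul_pow_sub_one (by omega) M

lemma le_pow_self_of_le {a M : ℕ} (ha : a ≤ M) (hM : 0 < M) : a ≤ M ^ M :=
  ha.trans (Nat.le_self_pow hM.ne' M)

/-- The centres of the bumps, the reciprocals of `eps (6 * k + 4)`. -/
noncomputable def bumpCenter (k : ℕ) : ℝ := 2 ^ ((6 * k + 4) ^ (6 * k + 4))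

lemma le_bumpCenter (k : ℕ) : (16 : ℝ) ≤ bumpCenter k := by
  have h : 4 ≤ (6 * k + 4) ^ (6 * k + 4) := le_pow_self_of_le (by omega) (by omega)
  calc (16 : ℝ) = 2 ^ 4 := by norm_num
    _ ≤ _ := pow_le_pow_right₀ (by norm_num) h

lemma two_mul_bumpCenter_le {i j : ℕ} (h : i < j) : 2 * bumpCenter i ≤ bumpCenter j := by
  have h1 : 2 * (6 * i + 4) ^ (6 * i + 4) ≤ (6 * j + 4) ^ (6 * j + 4) :=
    mul_pow_self_le (by omega) (by omega)
  have h2 : 0 < (6 * i + 4) ^ (6 * i + 4) := by positivity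
  rw [bumpCenter, bumpCenter, ← pow_succ']
  exact pow_le_pow_right₀ (by norm_num) (by omega)

lemma two_le_abs_bumpCenter_sub {i j : ℕ} (h : i ≠ j) :
    2 ≤ |bumpCenter i - bumpCenter j| := by
  rcases h.lt_or_gt with h | h
  · have := two_mul_bumpCenter_le h
    have := le_bumpCenter i
    rw [abs_sub_comm]
    exact le_trans (by linarith) (le_abs_self _)
  · have := two_mul_bumpCenter_le h
    have := le_bumpCenter j
    exact le_trans (by linarith) (le_abs_self _)

lemma tendsto_bumpCenter : Tendsto bumpCenter atTop atTop := by
  refine tendsto_atTop_mono (fun k => ?_) tendsto_natCast_atTop_atTop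
  have h1 : k ≤ (6 * k + 4) ^ (6 * k + 4) := le_pow_self_of_le (by omega) (by omega)
  have h2 : (6 * k + 4) ^ (6 * k + 4) < 2 ^ ((6 * k + 4) ^ (6 * k + 4)) := Nat.lt_two_pow_self
  rw [bumpCenter]
  exact_mod_cast h1.trans h2.le

section Translates

variable {b : ℝ → ℂ} {x : ℕ → ℝ}

/-- Superposition of the translates of `b` to the points `x k`. -/
noncomputable def sumTranslates (b : ℝ → ℂ) (x : ℕ → ℝ) (ξ : ℝ) : ℂ := ∑ᶠ k, b (ξ - x k)

lemma sumTranslates_eq_of_abs_lt (hb : ∀ t, 1 / 2 ≤ |t| → b t = 0)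
    (hx : ∀ i j, i ≠ j → 2 ≤ |x i - x j|) {ξ : ℝ} {k : ℕ} (hk : |ξ - x k| < 3 / 2) :
    sumTranslates b x ξ = b (ξ - x k) := by
  refine finsum_eq_single _ k fun j hj => hb _ ?_
  have h1 := hx j k hj
  have h2 := abs_sub_le (x j) ξ (x k)
  rw [abs_sub_comm (x j) ξ] at h2
  linarith

lemma sumTranslates_eq_zero (hb : ∀ t, 1 / 2 ≤ |t| → b t = 0) {ξ : ℝ}
    (hk : ∀ k, 1 / 2 ≤ |ξ - x k|) : sumTranslates b x ξ = 0 :=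
  finsum_eq_zero_of_forall_eq_zero fun k => hb _ (hk k)

lemma sumTranslates_eventuallyEq (hb : ∀ t, 1 / 2 ≤ |t| → b t = 0)
    (hx : ∀ i j, i ≠ j → 2 ≤ |x i - x j|) (ξ : ℝ) :
    ∃ y, sumTranslates b x =ᶠ[nhds ξ] fun t => b (t - y) := by
  have hball : ∀ᶠ t in nhds ξ, |t - ξ| < 1 / 2 := by
    filter_upwards [Metric.ball_mem_nhds ξ (ε := 1 / 2) (by norm_num)] with t ht
    rwa [Metric.mem_ball, Real.dist_eq] at ht
  by_cases h : ∃ k, |ξ - x k| < 1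
  · obtain ⟨k, hk⟩ := h
    refine ⟨x k, ?_⟩
    filter_upwards [hball] with t ht
    refine sumTranslates_eq_of_abs_lt hb hx ?_
    have := abs_sub_le t ξ (x k)
    linarith
  · push Not at h
    refine ⟨ξ + 1, ?_⟩
    filter_upwards [hball] with t ht
    rw [sumTranslates_eq_zero hb, hb]
    · rw [abs_lt] at ht
      rw [abs_sub_comm]
      exact le_trans (by linarith) (le_abs_self _)
    · intro k
      have h1 := abs_sub_le ξ t (x k)
      have h2 := h k
      rw [abs_sub_comm ξ t] at h1
      linarith

lemma contDiff_sumTranslates (hb : ∀ t, 1 / 2 ≤ |t| → b t = 0)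
    (hx : ∀ i j, i ≠ j → 2 ≤ |x i - x j|) (hs : ContDiff ℝ (⊤ : ℕ∞) b) :
    ContDiff ℝ (⊤ : ℕ∞) (sumTranslates b x) := by
  refine contDiff_iff_contDiffAt.2 fun ξ => ?_
  obtain ⟨y, hy⟩ := sumTranslates_eventuallyEq hb hx ξ
  exact (hs.comp (contDiff_id.sub contDiff_const)).contDiffAt.congr_of_eventuallyEq hy

lemma exists_bound_iteratedDeriv_sumTranslates (hb : ∀ t, 1 / 2 ≤ |t| → b t = 0)
    (hx : ∀ i j, i ≠ j → 2 ≤ |x i - x j|) (hs : ContDiff ℝ (⊤ : ℕ∞) b) (k : ℕ) :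
    ∃ C : ℝ, ∀ ξ, ‖iteratedDeriv k (sumTranslates b x) ξ‖ ≤ C := by
  have hc : HasCompactSupport b := by
    refine HasCompactSupport.intro (isCompact_Icc (a := (-1 : ℝ)) (b := 1)) fun t ht => hb t ?_
    by_contra! h
    rw [abs_lt] at h
    exact ht ⟨by linarith, by linarith⟩
  obtain ⟨C, hC⟩ := (hc.iteratedFDeriv (𝕜 := ℝ) k).exists_bound_of_continuous
    (hs.continuous_iteratedFDeriv (m := k) (by exact_mod_cast le_top))
  refine ⟨C, fun ξ => ?_⟩
  obtain ⟨y, hy⟩ := sumTranslates_eventuallyEq hb hx ξ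
  rw [hy.iteratedDeriv_eq, iteratedDeriv_comp_sub_const, ← norm_iteratedFDeriv_eq_norm_iteratedDeriv]
  exact hC _

end Translates

lemma SchwartzMap.exists_fourier_decay (φ : SchwartzMap ℝ ℂ) (j : ℕ) :
    ∃ C : ℝ, ∀ y : ℝ, |y| ^ j * ‖𝓕 (⇑φ) y‖ ≤ C := by
  obtain ⟨C, -, hC⟩ := (𝓕 φ).decay j 0
  refine ⟨C, fun y => ?_⟩
  simpa [← SchwartzMap.fourier_coe] using hC y

lemma japaneseBracket_pow_le {ξ X : ℝ} (hX : 16 ≤ X) (h : |ξ - X| < 1 / 2) (p : ℕ) :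
    (1 + ξ ^ 2) ^ ((p : ℝ) / 2) ≤ X ^ (2 * p) := by
  rw [abs_lt] at h
  have h1 : 1 + ξ ^ 2 ≤ (X ^ 2) ^ 2 := by
    have h2 : ξ ^ 2 ≤ (2 * X) ^ 2 := pow_le_pow_left₀ (by linarith) (by linarith) 2
    have h3 : 16 ^ 2 ≤ X ^ 2 := pow_le_pow_left₀ (by norm_num) hX 2
    nlinarith
  calc (1 + ξ ^ 2) ^ ((p : ℝ) / 2) ≤ ((X ^ 2) ^ 2) ^ ((p : ℝ) / 2) :=
        Real.rpow_le_rpow (by positivity) h1 (by positivity)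
    _ = X ^ (2 * p) := by
        rw [← Real.rpow_natCast (X ^ 2) 2, ← Real.rpow_mul (by positivity), pow_mul,
          ← Real.rpow_natCast (X ^ 2) p]
        congr 1
        push_cast
        ring

lemma sq_le_pow_four_mul {ε ξ X : ℝ} (hε : 0 < ε) (hX : 16 ≤ X) (h : |ξ - X| < 1 / 2)
    (hE : ε⁻¹ ^ 4 ≤ X) : X ^ 2 ≤ |ε * ξ| ^ 4 := by
  rw [abs_lt] at h
  have h1 : 1 ≤ ε ^ 4 * X := by
    rw [inv_pow] at hE
    exact (inv_le_iff_one_le_mul₀' (by positivity)).1 hE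
  have h2 : X / 2 ≤ ξ := by linarith
  rw [abs_of_nonneg (mul_nonneg hε.le (by linarith)), mul_pow]
  have h3 : (X / 2) ^ 4 ≤ ξ ^ 4 := pow_le_pow_left₀ (by linarith) h2 4
  calc X ^ 2 ≤ X ^ 3 / 16 := by nlinarith [sq_nonneg X]
    _ ≤ (ε ^ 4 * X) * (X ^ 3 / 16) := le_mul_of_one_le_left (by positivity) h1
    _ = ε ^ 4 * (X / 2) ^ 4 := by ring
    _ ≤ ε ^ 4 * ξ ^ 4 := by gcongr

/-- Headline counterexample, function-level: there is a smooth `F : ℝ → ℂ`, bounded together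
with all its derivatives, not tending to `0` at `+∞` (hence not Schwartz), such that for every
Schwartz `φ` and every `p` there is `N` with
`⟨ξ⟩^p |F(ξ)| |(𝓕φ)(εξ)| ≤ ε⁻¹` for all `n ≥ N`, `ε ∈ (ε_{6n+3}, ε_{6n}]`, and all `ξ`. -/
theorem stmt19 :
    ∃ F : ℝ → ℂ, ContDiff ℝ (⊤ : ℕ∞) F ∧
      (∀ k : ℕ, ∃ C : ℝ, ∀ ξ : ℝ, ‖iteratedDeriv k F ξ‖ ≤ C) ∧
      ¬ Tendsto F atTop (nhds 0) ∧
      ∀ φ : SchwartzMap ℝ ℂ, ∀ p : ℕ, ∃ N : ℕ, ∀ n : ℕ, N ≤ n →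
        ∀ ε : ℝ, eps (6 * n + 3) < ε → ε ≤ eps (6 * n) →
          ∀ ξ : ℝ, (1 + ξ ^ 2) ^ ((p : ℝ) / 2) * ‖F ξ‖ * ‖𝓕 (⇑φ) (ε * ξ)‖ ≤ ε⁻¹ := by
  let β : ContDiffBump (0 : ℝ) := ⟨1 / 4, 1 / 2, by norm_num, by norm_num⟩
  let b : ℝ → ℂ := fun t => (β t : ℂ)
  have hb : ∀ t, 1 / 2 ≤ |t| → b t = 0 := fun t ht => by
    have : β t = 0 := β.zero_of_le_dist (by simpa [Real.dist_eq, β] using ht)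
    simp [b, this]
  have hb0 : b 0 = 1 := by
    have : β 0 = 1 := β.one_of_mem_closedBall (by simp [β])
    simp [b, this]
  have hb1 : ∀ t, ‖b t‖ ≤ 1 := fun t => by
    simpa [b, abs_of_nonneg β.nonneg] using β.le_one
  have hs : ContDiff ℝ (⊤ : ℕ∞) b := Complex.ofRealCLM.contDiff.comp β.contDiff
  have hx : ∀ i j, i ≠ j → 2 ≤ |bumpCenter i - bumpCenter j| :=
    fun i j => two_le_abs_bumpCenter_sub
  refine ⟨sumTranslates b bumpCenter, contDiff_sumTranslates hb hx hs,
    exists_bound_iteratedDeriv_sumTranslates hb hx hs, fun h => ?_, fun φ p => ?_⟩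
  · have h1 := h.comp tendsto_bumpCenter
    have h2 : sumTranslates b bumpCenter ∘ bumpCenter = fun _ => 1 := by
      funext k
      rw [Function.comp_apply, sumTranslates_eq_of_abs_lt hb hx (k := k) (by norm_num),
        sub_self, hb0]
    rw [h2] at h1
    exact one_ne_zero (tendsto_nhds_unique tendsto_const_nhds h1)
  obtain ⟨C₀, hC₀⟩ := φ.exists_fourier_decay 0
  obtain ⟨C₁, hC₁⟩ := φ.exists_fourier_decay (4 * p)
  obtain ⟨c, hc⟩ := pow_unbounded_of_one_lt (max C₀ C₁) (one_lt_two : (1 : ℝ) < 2)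
  refine ⟨2 * p + c + 1, fun n hn ε hε₁ hε₂ ξ => ?_⟩
  have hε : 0 < ε := lt_trans (by unfold eps; positivity) hε₁
  have hE₁ : ε⁻¹ ≤ 2 ^ ((6 * n + 3) ^ (6 * n + 3)) :=
    inv_le_of_inv_le₀ (by positivity) hε₁.le
  have hE₂ : 2 ^ ((6 * n) ^ (6 * n)) ≤ ε⁻¹ :=
    (le_inv_comm₀ (by positivity) hε).2 hε₂
  by_cases h : ∃ k, |ξ - bumpCenter k| < 1 / 2
  swap
  · push Not at h
    rw [sumTranslates_eq_zero hb h]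
    simpa using hε.le
  obtain ⟨k, hk⟩ := h
  have hX := le_bumpCenter k
  have hF : ‖sumTranslates b bumpCenter ξ‖ ≤ 1 := by
    rw [sumTranslates_eq_of_abs_lt hb hx (hk.trans (by norm_num))]
    exact hb1 _
  have hbracket : (1 + ξ ^ 2) ^ ((p : ℝ) / 2) * ‖sumTranslates b bumpCenter ξ‖
      ≤ bumpCenter k ^ (2 * p) :=
    (mul_le_of_le_one_right (by positivity) hF).trans (japaneseBracket_pow_le hX hk p)
  refine (mul_le_mul_of_nonneg_right hbracket (norm_nonneg _)).trans ?_
  rcases lt_or_ge k n with hkn | hkn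
  · have h0 : ‖𝓕 (⇑φ) (ε * ξ)‖ ≤ 2 ^ c := by
      have := hC₀ (ε * ξ)
      rw [pow_zero, one_mul] at this
      exact this.trans ((le_max_left _ _).trans hc.le)
    have hm : 1 ≤ (6 * k + 4) ^ (6 * k + 4) := Nat.one_le_pow _ _ (by omega)
    have hexp : (6 * k + 4) ^ (6 * k + 4) * (2 * p) + c ≤ (6 * n) ^ (6 * n) := by
      have := mul_pow_self_le (a := 2 * p + c) (m := 6 * k + 4) (M := 6 * n)
        (by omega) (by omega)
      nlinarith
    calc bumpCenter k ^ (2 * p) * ‖𝓕 (⇑φ) (ε * ξ)‖ ≤ bumpCenter k ^ (2 * p) * 2 ^ c := by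
          gcongr
      _ = 2 ^ ((6 * k + 4) ^ (6 * k + 4) * (2 * p) + c) := by
          rw [bumpCenter, ← pow_mul, ← pow_add]
      _ ≤ 2 ^ ((6 * n) ^ (6 * n)) := pow_le_pow_right₀ (by norm_num) hexp
      _ ≤ ε⁻¹ := hE₂
  · have hE : ε⁻¹ ^ 4 ≤ bumpCenter k := by
      calc ε⁻¹ ^ 4 ≤ (2 ^ ((6 * n + 3) ^ (6 * n + 3))) ^ 4 := by gcongr
        _ = 2 ^ (4 * (6 * n + 3) ^ (6 * n + 3)) := by rw [← pow_mul, mul_comm]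
        _ ≤ _ := pow_le_pow_right₀ (by norm_num) (mul_pow_self_le (by omega) (by omega))
    have hpow : bumpCenter k ^ (2 * p) ≤ |ε * ξ| ^ (4 * p) := by
      rw [pow_mul, pow_mul]
      exact pow_le_pow_left₀ (by positivity) (sq_le_pow_four_mul hε hX hk hE) p
    have hcn : c ≤ (6 * n) ^ (6 * n) := le_pow_self_of_le (by omega) (by omega)
    calc bumpCenter k ^ (2 * p) * ‖𝓕 (⇑φ) (ε * ξ)‖
        ≤ |ε * ξ| ^ (4 * p) * ‖𝓕 (⇑φ) (ε * ξ)‖ := by gcongr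
      _ ≤ C₁ := hC₁ _
      _ ≤ 2 ^ c := (le_max_right _ _).trans hc.le
      _ ≤ 2 ^ ((6 * n) ^ (6 * n)) := pow_le_pow_right₀ (by norm_num) hcn
      _ ≤ ε⁻¹ := hE₂
end
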